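/- Let β > 0, A finite nonempty, Q_old : A → ℝ, a_k ∈ A, δ ∈ ℝ, Q_new(a) = Q_old(a) + (if a = a_k then δ else 0), π_old = softmax(Q_old/β), π_new = softmax(Q_new/β). Then the soft policy improvement value PIV^soft = ∑_a (π_new(a) - π_old(a))·Q_new(a) + β·(H(π_new) - H(π_old)) satisfies PIV^soft ≤ max{π_old(a_k), π_new(a_k)}·|δ|. -/

import Mathlib

/-- Gibbs' inequality for positive weights of equal total mass. -/
theorem sum_mul_log_le_sum_mul_log {A : Type*} [Fintype A] (p q : A → ℝ)
    (hp : ∀ a, 0 < p a) (hq : ∀ a, 0 < q a) (hpq : ∑ a, p a = ∑ a, q a) :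
    ∑ a, p a * Real.log (q a) ≤ ∑ a, p a * Real.log (p a) := by
  have h : ∑ a, (p a * Real.log (q a) - p a * Real.log (p a)) ≤ ∑ a, (q a - p a) := by
    refine Finset.sum_le_sum fun a _ => ?_
    have h1 := Real.log_le_sub_one_of_pos (div_pos (hq a) (hp a))
    rw [Real.log_div (hq a).ne' (hp a).ne'] at h1
    have h2 := mul_le_mul_of_nonneg_left h1 (hp a).le
    have h3 : p a * (q a / p a - 1) = q a - p a := by
      have := (hp a).ne'
      field_simp
    linarith
  simp only [Finset.sum_sub_distrib] at h
  linarith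

theorem softmax_pos {A : Type*} [Fintype A] [Nonempty A] (β : ℝ) (Q : A → ℝ) (a : A) :
    0 < Real.exp (Q a / β) / ∑ b, Real.exp (Q b / β) := by
  positivity

theorem sum_softmax {A : Type*} [Fintype A] [Nonempty A] (β : ℝ) (Q : A → ℝ) :
    ∑ a, Real.exp (Q a / β) / ∑ b, Real.exp (Q b / β) = 1 := by
  rw [← Finset.sum_div]
  exact div_self (by positivity)

/-- The cross-entropy of a normalized weight relative to a softmax distribution. -/
theorem mul_sum_mul_log_softmax {A : Type*} [Fintype A] [Nonempty A] {β : ℝ} (hβ : β ≠ 0)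
    (Q μ : A → ℝ) (hμ : ∑ a, μ a = 1) :
    β * ∑ a, μ a * Real.log (Real.exp (Q a / β) / ∑ b, Real.exp (Q b / β)) =
      ∑ a, μ a * Q a - β * Real.log (∑ b, Real.exp (Q b / β)) := by
  have h : ∀ a, β * (μ a * Real.log (Real.exp (Q a / β) / ∑ b, Real.exp (Q b / β))) =
      μ a * Q a - μ a * (β * Real.log (∑ b, Real.exp (Q b / β))) := fun a => by
    rw [Real.log_div (by positivity) (by positivity), Real.log_exp]
    field_simp
  rw [Finset.mul_sum, Finset.sum_congr rfl fun a _ => h a, Finset.sum_sub_distrib,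
    ← Finset.sum_mul, hμ, one_mul]

theorem soft_piv_upper_bound {A : Type*} [Fintype A] [Nonempty A] [DecidableEq A]
    (β : ℝ) (hβ : 0 < β) (Q_old : A → ℝ) (a_k : A) (δ : ℝ)
    (Q_new : A → ℝ) (hQ : ∀ a, Q_new a = Q_old a + (if a = a_k then δ else 0))
    (π_old π_new : A → ℝ)
    (hold : ∀ a, π_old a = Real.exp (Q_old a / β) / ∑ b, Real.exp (Q_old b / β))
    (hnew : ∀ a, π_new a = Real.exp (Q_new a / β) / ∑ b, Real.exp (Q_new b / β))
    (H : (A → ℝ) → ℝ) (hH : ∀ π, H π = -∑ a, π a * Real.log (π a)) :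
    (∑ a, (π_new a - π_old a) * Q_new a) + β * (H π_new - H π_old) ≤
      max (π_old a_k) (π_new a_k) * |δ| := by
  have hop : ∀ a, 0 < π_old a := fun a => hold a ▸ softmax_pos β Q_old a
  have hnp : ∀ a, 0 < π_new a := fun a => hnew a ▸ softmax_pos β Q_new a
  have hos : ∑ a, π_old a = 1 := by simp_rw [hold, sum_softmax]
  have hns : ∑ a, π_new a = 1 := by simp_rw [hnew, sum_softmax]
  have shift : ∀ μ : A → ℝ, ∑ a, μ a * Q_new a = ∑ a, μ a * Q_old a + μ a_k * δ := fun μ => by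
    simp [hQ, mul_add, Finset.sum_add_distrib]
  have old_old := mul_sum_mul_log_softmax hβ.ne' Q_old π_old hos
  have new_old := mul_sum_mul_log_softmax hβ.ne' Q_old π_new hns
  have new_new := mul_sum_mul_log_softmax hβ.ne' Q_new π_new hns
  simp only [← hold, ← hnew] at old_old new_old new_new
  have gibbs := mul_le_mul_of_nonneg_left
    (sum_mul_log_le_sum_mul_log π_new π_old hnp hop (hns.trans hos.symm)) hβ.le
  have bound : (∑ a, (π_new a - π_old a) * Q_new a) + β * (H π_new - H π_old) ≤
      (π_new a_k - π_old a_k) * δ := by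
    simp only [hH, sub_mul, Finset.sum_sub_distrib]
    linarith [shift π_old, shift π_new]
  refine bound.trans ?_
  calc (π_new a_k - π_old a_k) * δ ≤ |π_new a_k - π_old a_k| * |δ| := by
        rw [← abs_mul]; exact le_abs_self _
    _ ≤ max (π_old a_k) (π_new a_k) * |δ| := by
        refine mul_le_mul_of_nonneg_right (abs_le.mpr ⟨?_, ?_⟩) (abs_nonneg δ)
        · linarith [le_max_left (π_old a_k) (π_new a_k), hnp a_k]
        · linarith [le_max_right (π_old a_k) (π_new a_k), hop a_k]
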